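/- Let 𝒞 be a set of unsatisfiable CNF formulas closed under factorisation, let 𝒞ˢⁱ ⊆ 𝒞 be the strongly irreducible formulas of 𝒞, and let μ : ℕ → ℕ be a non-decreasing function such that every F ∈ 𝒞ˢⁱ has a resolution refutation of length at most μ(|F|). Then every F ∈ 𝒞 has a resolution refutation of length at most (|F| − 1)·μ(|F|) + 1, where |F| denotes the number of clauses of F. -/

import Mathlib

/-- A literal: a variable (natural number) with a polarity. -/
abbrev Lit : Type := ℕ × Bool

/-- Negation of a literal. -/
def Lit.neg (ℓ : Lit) : Lit := (ℓ.1, !ℓ.2)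

/-- A clause: a finite set of literals. -/
abbrev Clause : Type := Finset Lit

/-- A clause is non-tautological: it contains no literal together with its negation. -/
def Clause.NonTaut (C : Clause) : Prop := ∀ ℓ ∈ C, Lit.neg ℓ ∉ C

/-- A CNF formula: a finite set of clauses. -/
abbrev CNF : Type := Finset Clause

/-- A CNF formula is well-formed if all of its clauses are non-tautological. -/
def CNF.WellFormed (F : CNF) : Prop := ∀ C ∈ F, C.NonTaut

/-- A (total) assignment `τ` satisfies a literal. -/
def SatLit (τ : ℕ → Bool) (ℓ : Lit) : Prop := τ ℓ.1 = ℓ.2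

/-- An assignment satisfies a clause if it satisfies some literal of it. -/
def SatClause (τ : ℕ → Bool) (C : Clause) : Prop := ∃ ℓ ∈ C, SatLit τ ℓ

/-- An assignment satisfies a CNF formula if it satisfies all of its clauses. -/
def SatCNF (τ : ℕ → Bool) (F : CNF) : Prop := ∀ C ∈ F, SatClause τ C

/-- A CNF formula is unsatisfiable if no assignment satisfies it. -/
def Unsat (F : CNF) : Prop := ¬ ∃ τ : ℕ → Bool, SatCNF τ F

/-- `F` entails `G`: every model of `F` is a model of `G`. -/
def Entails (F G : CNF) : Prop := ∀ τ : ℕ → Bool, SatCNF τ F → SatCNF τ G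

/-- Logical equivalence of CNF formulas. -/
def Equivalent (F G : CNF) : Prop := Entails F G ∧ Entails G F

/-- Two clauses clash: one contains a literal whose negation is in the other. -/
def Clash (C D : Clause) : Prop := ∃ ℓ ∈ C, Lit.neg ℓ ∈ D

/-- A formula is hitting if every pair of distinct clauses clashes. -/
def Hitting (F : CNF) : Prop := ∀ C ∈ F, ∀ D ∈ F, C ≠ D → Clash C D

/-- The set of variables occurring in a CNF formula. -/
def cnfVars (F : CNF) : Finset ℕ := F.sup fun C => C.image Prod.fst

/-- `D` is the resolvent of `C₁` and `C₂` (on the unique clashing literal `ℓ`). -/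
def Resolvent (C₁ C₂ D : Clause) : Prop :=
  ∃ ℓ : Lit, C₁ ∩ C₂.image Lit.neg = {ℓ} ∧ D = (C₁ ∪ C₂) \ {ℓ, Lit.neg ℓ}

/-- `L` is a resolution refutation of `F`: every clause of the sequence is an axiom
(clause of `F`) or a resolvent of two earlier clauses, and the last clause is empty. -/
def IsRefutation (F : CNF) (L : List Clause) : Prop :=
  L ≠ [] ∧ L.getLast? = some (∅ : Clause) ∧
    ∀ i < L.length, L.getD i ∅ ∈ F ∨
      ∃ j k, j < i ∧ k < i ∧ Resolvent (L.getD j ∅) (L.getD k ∅) (L.getD i ∅)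

/-- Resolution hardness: the minimum length of a resolution refutation. -/
noncomputable def hardness (F : CNF) : ℕ :=
  sInf {n | ∃ L : List Clause, IsRefutation F L ∧ L.length = n}

/-- The restriction `F[¬C]`: the result of setting all literals of `C` to 0 in `F`. -/
def restrictByNegC (F : CNF) (C : Clause) : CNF :=
  (F.filter fun D => ∀ ℓ ∈ C, Lit.neg ℓ ∉ D).image fun D => D \ C

/-- `C` is a clause interpolant of `(F, H)`: `F ⊨ C` and `{C} ∪ H` is unsatisfiable. -/
def ClauseInterpolant (C : Clause) (F H : CNF) : Prop :=
  C.NonTaut ∧ Entails F {C} ∧ Unsat (insert C H)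

/-- `F` is a factor of `G`: a subset of `G` logically equivalent to a single clause. -/
def IsFactor (F G : CNF) : Prop :=
  F ⊆ G ∧ ∃ C : Clause, C.NonTaut ∧ Equivalent F {C}

/-- `F` is a pseudo-factor of `G`: `(F, G \ F)` has a clause interpolant. -/
def IsPseudoFactor (F G : CNF) : Prop :=
  F ⊆ G ∧ ∃ C : Clause, ClauseInterpolant C F (G \ F)

/-- `G` is irreducible: every factor has size 1 or `|G|`. -/
def CNF.Irreducible (G : CNF) : Prop :=
  ∀ F : CNF, IsFactor F G → F.card = 1 ∨ F.card = G.card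

/-- `G` is strongly irreducible: every pseudo-factor has size 1 or `|G|`. -/
def StronglyIrreducible (G : CNF) : Prop :=
  ∀ F : CNF, IsPseudoFactor F G → F.card = 1 ∨ F.card = G.card

/-- `F` is minimally unsatisfiable: unsatisfiable, but every proper subset is satisfiable. -/
def MinimallyUnsat (F : CNF) : Prop :=
  Unsat F ∧ ∀ G : CNF, G ⊂ F → ∃ τ : ℕ → Bool, SatCNF τ G

/-- `G` is weakly reducible: not strongly irreducible. -/
def WeaklyReducible (G : CNF) : Prop := ¬ StronglyIrreducible G

/-- A set `𝒞` of formulas is closed under factorisation: for every weakly reducible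
`G ∈ 𝒞`, every pseudo-factor `F` of `G` and clause interpolant `C` of `(F, G \ F)`,
both `F[¬C]` and `(G \ F) ∪ {C}` are in `𝒞`. -/
def ClosedUnderFactorisation (𝒞 : Set CNF) : Prop :=
  ∀ G ∈ 𝒞, WeaklyReducible G → ∀ F : CNF, F ⊆ G → ∀ C : Clause,
    ClauseInterpolant C F (G \ F) →
      restrictByNegC F C ∈ 𝒞 ∧ insert C (G \ F) ∈ 𝒞

@[simp] theorem Lit.neg_neg (ℓ : Lit) : ℓ.neg.neg = ℓ := by
  simp [Lit.neg]

theorem mem_image_neg {ℓ : Lit} {C : Clause} : ℓ ∈ C.image Lit.neg ↔ ℓ.neg ∈ C := by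
  rw [Finset.mem_image]
  constructor
  · rintro ⟨m, hm, rfl⟩
    simpa using hm
  · exact fun h => ⟨ℓ.neg, h, by simp⟩

theorem resolvent_iff {A B D : Clause} :
    Resolvent A B D ↔ ∃ ℓ ∈ A, ℓ.neg ∈ B ∧ (∀ m ∈ A, m.neg ∈ B → m = ℓ) ∧
      ∀ m, m ∈ D ↔ (m ∈ A ∨ m ∈ B) ∧ m ≠ ℓ ∧ m ≠ ℓ.neg := by
  unfold Resolvent
  refine exists_congr fun ℓ => ?_
  simp only [Finset.ext_iff, Finset.mem_inter, mem_image_neg, Finset.mem_singleton,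
    Finset.mem_sdiff, Finset.mem_union, Finset.mem_insert, not_or]
  constructor
  · rintro ⟨h, hD⟩
    exact ⟨((h ℓ).2 rfl).1, ((h ℓ).2 rfl).2, fun m hm hm' => (h m).1 ⟨hm, hm'⟩, hD⟩
  · rintro ⟨hA, hB, h, hD⟩
    refine ⟨fun m => ⟨fun hm => h m hm.1 hm.2, ?_⟩, hD⟩
    rintro rfl
    exact ⟨hA, hB⟩

/-- `ResolutionDerivation F L`: every clause of `L` is a clause of `F` or a
resolvent of two earlier clauses of `L`. -/
inductive ResolutionDerivation (F : CNF) : List Clause → Prop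
  | nil : ResolutionDerivation F []
  | snoc {L : List Clause} {D : Clause} : ResolutionDerivation F L →
      (D ∈ F ∨ ∃ A ∈ L, ∃ B ∈ L, Resolvent A B D) → ResolutionDerivation F (L ++ [D])

namespace ResolutionDerivation

theorem of_getD {F : CNF} (L : List Clause)
    (h : ∀ i < L.length, L.getD i ∅ ∈ F ∨
      ∃ j k, j < i ∧ k < i ∧ Resolvent (L.getD j ∅) (L.getD k ∅) (L.getD i ∅)) :
    ResolutionDerivation F L := by
  induction L using List.reverseRecOn with
  | nil => exact nil
  | append_singleton L D ih =>
    have hget : ∀ i < L.length, (L ++ [D]).getD i ∅ = L.getD i ∅ :=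
      fun i hi => List.getD_append _ _ _ _ hi
    have hlast : (L ++ [D]).getD L.length ∅ = D := by simp
    have hmem : ∀ i < L.length, L.getD i ∅ ∈ L := fun i hi => by
      rw [List.getD_eq_getElem _ _ hi]
      exact List.getElem_mem hi
    refine snoc (ih fun i hi => ?_) ?_
    · have := h i (by simp; omega)
      rw [hget i hi] at this
      refine this.imp_right ?_
      rintro ⟨j, k, hj, hk, hr⟩
      rw [hget j (hj.trans hi), hget k (hk.trans hi)] at hr
      exact ⟨j, k, hj, hk, hr⟩
    · have := h L.length (by simp)
      rw [hlast] at this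
      refine this.imp_right ?_
      rintro ⟨j, k, hj, hk, hr⟩
      rw [hget j hj, hget k hk] at hr
      exact ⟨_, hmem j hj, _, hmem k hk, hr⟩

theorem getD_spec {F : CNF} {L : List Clause} (h : ResolutionDerivation F L) :
    ∀ i < L.length, L.getD i ∅ ∈ F ∨
      ∃ j k, j < i ∧ k < i ∧ Resolvent (L.getD j ∅) (L.getD k ∅) (L.getD i ∅) := by
  induction h with
  | nil => simp
  | @snoc L D _ hD ih =>
    have hget : ∀ i < L.length, (L ++ [D]).getD i ∅ = L.getD i ∅ :=
      fun i hi => List.getD_append _ _ _ _ hi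
    intro i hi
    rcases Nat.lt_or_ge i L.length with hiL | hiL
    · rw [hget i hiL]
      refine (ih i hiL).imp_right ?_
      rintro ⟨j, k, hj, hk, hr⟩
      refine ⟨j, k, hj, hk, ?_⟩
      rwa [hget j (hj.trans hiL), hget k (hk.trans hiL)]
    · obtain rfl : i = L.length := by
        simp at hi
        omega
      have hlast : (L ++ [D]).getD L.length ∅ = D := by simp
      rw [hlast]
      refine hD.imp_right ?_
      rintro ⟨A, hA, B, hB, hr⟩
      obtain ⟨j, hj, rfl⟩ := List.getElem_of_mem hA
      obtain ⟨k, hk, rfl⟩ := List.getElem_of_mem hB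
      refine ⟨j, k, hj, hk, ?_⟩
      rwa [hget j hj, hget k hk, List.getD_eq_getElem _ _ hj, List.getD_eq_getElem _ _ hk]

theorem exists_isRefutation {F : CNF} {L : List Clause} (h : ResolutionDerivation F L)
    (h0 : ∅ ∈ L) : ∃ K, IsRefutation F K ∧ K.length ≤ L.length := by
  induction h with
  | nil => simp at h0
  | @snoc L D hL hD ih =>
    by_cases hm : ∅ ∈ L
    · obtain ⟨K, hK, hlen⟩ := ih hm
      exact ⟨K, hK, by simp; omega⟩
    · obtain rfl : ∅ = D := by simpa [hm] using h0
      exact ⟨L ++ [∅], ⟨by simp, by simp, (snoc hL hD).getD_spec⟩, le_rfl⟩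

end ResolutionDerivation

theorem IsRefutation.derivation {F : CNF} {L : List Clause} (h : IsRefutation F L) :
    ResolutionDerivation F L :=
  .of_getD L h.2.2

theorem IsRefutation.empty_mem {F : CNF} {L : List Clause} (h : IsRefutation F L) : ∅ ∈ L :=
  List.mem_of_getLast? h.2.1

namespace ResolutionDerivation

/-- A derivation from `F[¬C]` lifts to a derivation from `F`, adding only literals of `C`. -/
theorem lift_restrict {F : CNF} {C : Clause} (hC : C.NonTaut) {L : List Clause}
    (h : ResolutionDerivation (restrictByNegC F C) L) :
    ∃ N, ResolutionDerivation F N ∧ N.length = L.length ∧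
      ∀ D ∈ L, (∀ ℓ ∈ D, ℓ.neg ∉ C) ∧ ∃ E ∈ N, D ⊆ E ∧ E ⊆ D ∪ C := by
  induction h with
  | nil => exact ⟨[], nil, rfl, by simp⟩
  | @snoc L D _ hD ih =>
    obtain ⟨N, hN, hlen, hcov⟩ := ih
    suffices hs : ∃ E, (E ∈ F ∨ ∃ A ∈ N, ∃ B ∈ N, Resolvent A B E) ∧
        (∀ ℓ ∈ D, ℓ.neg ∉ C) ∧ D ⊆ E ∧ E ⊆ D ∪ C by
      obtain ⟨E, hE, hDC, hDE, hED⟩ := hs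
      refine ⟨N ++ [E], snoc hN hE, by simp [hlen], fun D' hD' => ?_⟩
      rcases List.mem_append.1 hD' with hD' | hD'
      · obtain ⟨h1, E', hE', h2⟩ := hcov D' hD'
        exact ⟨h1, E', List.mem_append_left _ hE', h2⟩
      · obtain rfl := List.mem_singleton.1 hD'
        exact ⟨hDC, E, by simp, hDE, hED⟩
    rcases hD with hD | ⟨A, hA, B, hB, hr⟩
    · simp only [restrictByNegC, Finset.mem_image, Finset.mem_filter] at hD
      obtain ⟨E, ⟨hE, hEC⟩, rfl⟩ := hD
      refine ⟨E, Or.inl hE, fun ℓ hℓ hℓC => ?_, Finset.sdiff_subset, ?_⟩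
      · refine hEC _ hℓC ?_
        simpa using (Finset.mem_sdiff.1 hℓ).1
      · intro ℓ hℓ
        simp only [Finset.mem_union, Finset.mem_sdiff]
        tauto
    · obtain ⟨hAC, A', hA', hAA', hA'A⟩ := hcov A hA
      obtain ⟨hBC, B', hB', hBB', hB'B⟩ := hcov B hB
      obtain ⟨ℓ, hℓA, hℓB, huniq, hmem⟩ := resolvent_iff.1 hr
      have hℓC : ℓ ∉ C := by simpa using hBC _ hℓB
      refine ⟨(A' ∪ B') \ {ℓ, ℓ.neg}, Or.inr ⟨A', hA', B', hB', ?_⟩, ?_, ?_, ?_⟩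
      · refine resolvent_iff.2 ⟨ℓ, hAA' hℓA, hBB' hℓB, fun m hm hm' => ?_, fun m => by simp⟩
        rcases Finset.mem_union.1 (hA'A hm) with hm | hm <;>
          rcases Finset.mem_union.1 (hB'B hm') with hm' | hm'
        · exact huniq m hm hm'
        · exact absurd hm' (hAC m hm)
        · exact absurd (by simpa using hm) (hBC _ hm')
        · exact absurd hm' (hC m hm)
      · intro m hm
        rcases ((hmem m).1 hm).1 with h | h
        · exact hAC m h
        · exact hBC m h
      · intro m hm
        obtain ⟨h, h1, h2⟩ := (hmem m).1 hm
        simp only [Finset.mem_sdiff, Finset.mem_union, Finset.mem_insert, Finset.mem_singleton]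
        exact ⟨h.imp (@hAA' m) (@hBB' m), by tauto⟩
      · intro m hm
        simp only [Finset.mem_sdiff, Finset.mem_union, Finset.mem_insert,
          Finset.mem_singleton] at hm ⊢
        have hA := @hA'A m
        have hB := @hB'B m
        rw [Finset.mem_union] at hA hB
        rw [hmem m]
        tauto

end ResolutionDerivation

/-- `E` is a subclause of `D` that contains both or neither of any two complementary
literals of `D`. Clauses may be tautological here, and plain inclusion is not preserved by
resolution on tautological clauses. -/
def StrongSubsumes (E D : Clause) : Prop :=
  E ⊆ D ∧ ∀ ℓ ∈ E, ℓ.neg ∈ D → ℓ.neg ∈ E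

theorem StrongSubsumes.refl (D : Clause) : StrongSubsumes D D :=
  ⟨subset_rfl, fun _ _ h => h⟩

theorem Clause.NonTaut.strongSubsumes {C E : Clause} (hC : C.NonTaut) (h : E ⊆ C) :
    StrongSubsumes E C :=
  ⟨h, fun ℓ hℓ hn => absurd hn (hC ℓ (h hℓ))⟩

theorem StrongSubsumes.resolvent {A B D A' B' : Clause} (hA : StrongSubsumes A' A)
    (hB : StrongSubsumes B' B) (hr : Resolvent A B D) :
    StrongSubsumes A' D ∨ StrongSubsumes B' D ∨
      ∃ D', Resolvent A' B' D' ∧ StrongSubsumes D' D := by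
  obtain ⟨ℓ, hℓA, hℓB, huniq, hmem⟩ := resolvent_iff.1 hr
  have keyA : ∀ m ∈ A', m ≠ ℓ → m.neg ∈ D → m.neg ∈ A' := fun m hm hne hD => by
    rcases ((hmem _).1 hD).1 with h | h
    · exact hA.2 m hm h
    · exact absurd (huniq m (hA.1 hm) h) hne
  have keyB : ∀ m ∈ B', m ≠ ℓ.neg → m.neg ∈ D → m.neg ∈ B' := fun m hm hne hD => by
    rcases ((hmem _).1 hD).1 with h | h
    · have := huniq _ h (by simpa using hB.1 hm)
      exact absurd (by simp [← this]) hne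
    · exact hB.2 m hm h
  by_cases h1 : ℓ ∈ A'
  · by_cases h2 : ℓ.neg ∈ B'
    · refine Or.inr (Or.inr ⟨(A' ∪ B') \ {ℓ, ℓ.neg}, resolvent_iff.2
        ⟨ℓ, h1, h2, fun m hm hm' => huniq m (hA.1 hm) (hB.1 hm'), fun m => by simp⟩, ?_, ?_⟩)
      · intro m hm
        simp only [Finset.mem_sdiff, Finset.mem_union, Finset.mem_insert,
          Finset.mem_singleton] at hm
        have := @hA.1 m
        have := @hB.1 m
        rw [hmem m]
        tauto
      · intro m hm hn
        have hne := ((hmem _).1 hn).2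
        simp only [Finset.mem_sdiff, Finset.mem_union, Finset.mem_insert,
          Finset.mem_singleton, not_or] at hm ⊢
        exact ⟨hm.1.imp (fun h => keyA m h hm.2.1 hn) (fun h => keyB m h hm.2.2 hn), hne⟩
    · have h3 : ℓ ∉ B' := fun h => h2 (hB.2 ℓ h hℓB)
      have hne : ∀ m ∈ B', m ≠ ℓ ∧ m ≠ ℓ.neg := fun m hm =>
        ⟨fun h => h3 (h ▸ hm), fun h => h2 (h ▸ hm)⟩
      exact Or.inr (Or.inl ⟨fun m hm => (hmem m).2 ⟨Or.inr (hB.1 hm), hne m hm⟩,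
        fun m hm => keyB m hm (hne m hm).2⟩)
  · have h3 : ℓ.neg ∉ A' := fun h => h1 (by simpa using hA.2 _ h (by simpa using hℓA))
    have hne : ∀ m ∈ A', m ≠ ℓ ∧ m ≠ ℓ.neg := fun m hm =>
      ⟨fun h => h1 (h ▸ hm), fun h => h3 (h ▸ hm)⟩
    exact Or.inl ⟨fun m hm => (hmem m).2 ⟨Or.inl (hA.1 hm), hne m hm⟩,
      fun m hm => keyA m hm (hne m hm).1⟩

namespace ResolutionDerivation

/-- If a subclause of the non-tautological clause `C` is derived in `M`, a derivation `L` that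
uses `C` as an axiom can be appended to `M`, saving the line of `C` if it occurs in `L`. -/
theorem append_subsume {G H : CNF} (hHG : H ⊆ G) {C C' : Clause} (hC : C.NonTaut)
    (hC' : C' ⊆ C) {M : List Clause} (hM : ResolutionDerivation G M) (hC'M : C' ∈ M) {L : List Clause}
    (hL : ResolutionDerivation (insert C H) L) :
    ∃ N, ResolutionDerivation G N ∧ C' ∈ N ∧ (∀ D ∈ L, ∃ E ∈ N, StrongSubsumes E D) ∧
      N.length ≤ M.length + L.length ∧ (C ∈ L → N.length + 1 ≤ M.length + L.length) := by
  induction hL with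
  | nil => exact ⟨M, hM, hC'M, by simp, by simp, by simp⟩
  | @snoc L D _ hD ih =>
    obtain ⟨N, hN, hC'N, hcov, hlen, hlen'⟩ := ih
    have extend : (∃ E ∈ N, StrongSubsumes E D) →
        ∃ N, ResolutionDerivation G N ∧ C' ∈ N ∧ (∀ D' ∈ L ++ [D], ∃ E ∈ N, StrongSubsumes E D') ∧
          N.length ≤ M.length + (L ++ [D]).length ∧
          (C ∈ L ++ [D] → N.length + 1 ≤ M.length + (L ++ [D]).length) := by
      refine fun hE => ⟨N, hN, hC'N, fun D' hD' => ?_, by simp; omega, fun _ => by simp; omega⟩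
      rcases List.mem_append.1 hD' with h | h
      · exact hcov D' h
      · rwa [List.mem_singleton.1 h]
    by_cases hDC : D = C
    · exact extend ⟨C', hC'N, hDC ▸ hC.strongSubsumes hC'⟩
    have extend' : ∀ E, (E ∈ G ∨ ∃ A ∈ N, ∃ B ∈ N, Resolvent A B E) → StrongSubsumes E D →
        ∃ N, ResolutionDerivation G N ∧ C' ∈ N ∧ (∀ D' ∈ L ++ [D], ∃ E ∈ N, StrongSubsumes E D') ∧
          N.length ≤ M.length + (L ++ [D]).length ∧
          (C ∈ L ++ [D] → N.length + 1 ≤ M.length + (L ++ [D]).length) := by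
      refine fun E hE hED => ⟨N ++ [E], snoc hN hE, List.mem_append_left _ hC'N,
        fun D' hD' => ?_, by simp; omega, fun hCL => ?_⟩
      · rcases List.mem_append.1 hD' with h | h
        · obtain ⟨E', hE', hs⟩ := hcov D' h
          exact ⟨E', List.mem_append_left _ hE', hs⟩
        · rw [List.mem_singleton.1 h]
          exact ⟨E, by simp, hED⟩
      · rcases List.mem_append.1 hCL with h | h
        · have := hlen' h
          simp only [List.length_append, List.length_singleton]
          omega
        · exact absurd (List.mem_singleton.1 h).symm hDC
    rcases hD with hD | ⟨A, hA, B, hB, hr⟩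
    · exact extend' D (Or.inl (hHG ((Finset.mem_insert.1 hD).resolve_left hDC))) (.refl D)
    · obtain ⟨A', hA', hAs⟩ := hcov A hA
      obtain ⟨B', hB', hBs⟩ := hcov B hB
      rcases hAs.resolvent hBs hr with h | h | ⟨D', hD', h⟩
      · exact extend ⟨A', hA', h⟩
      · exact extend ⟨B', hB', h⟩
      · exact extend' D' (Or.inr ⟨A', hA', B', hB', hD'⟩) h

theorem of_insert_of_notMem {G H : CNF} (hHG : H ⊆ G) {C : Clause} {L : List Clause}
    (hL : ResolutionDerivation (insert C H) L) (hC : C ∉ L) : ResolutionDerivation G L := by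
  induction hL with
  | nil => exact nil
  | @snoc L D _ hD ih =>
    simp only [List.mem_append, List.mem_singleton, not_or] at hC
    refine snoc (ih hC.1) (hD.imp_left fun h => hHG ?_)
    exact (Finset.mem_insert.1 h).resolve_left (Ne.symm hC.2)

end ResolutionDerivation

theorem exists_isRefutation_of_factorisation {F G : CNF} (hFG : F ⊆ G) {C : Clause}
    (hC : C.NonTaut) {L₁ L₂ : List Clause} (h₁ : IsRefutation (restrictByNegC F C) L₁)
    (h₂ : IsRefutation (insert C (G \ F)) L₂) :
    ∃ L, IsRefutation G L ∧ L.length + 1 ≤ L₁.length + L₂.length := by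
  have hHG : G \ F ⊆ G := Finset.sdiff_subset
  by_cases hCL : C ∈ L₂
  · obtain ⟨M, hM, hMlen, hcov⟩ := h₁.derivation.lift_restrict hC
    obtain ⟨-, C', hC'M, -, hC'⟩ := hcov ∅ h₁.empty_mem
    have hMG : ResolutionDerivation G M := by
      clear hC'M hMlen hcov
      induction hM with
      | nil => exact .nil
      | snoc _ hD ih => exact .snoc ih (hD.imp_left fun h => hFG h)
    obtain ⟨N, hN, -, hNcov, -, hlen⟩ :=
      hMG.append_subsume hHG hC (by simpa using hC') hC'M h₂.derivation
    obtain ⟨E, hE, hs⟩ := hNcov ∅ h₂.empty_mem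
    obtain rfl := Finset.subset_empty.1 hs.1
    obtain ⟨K, hK, hKlen⟩ := hN.exists_isRefutation hE
    have := hlen hCL
    exact ⟨K, hK, by omega⟩
  · obtain ⟨K, hK, hKlen⟩ :=
      (h₂.derivation.of_insert_of_notMem hHG hCL).exists_isRefutation h₂.empty_mem
    have := List.length_pos_iff.2 h₁.1
    exact ⟨K, hK, by omega⟩

theorem not_unsat_empty : ¬ Unsat ∅ := fun h => h ⟨fun _ => true, by simp [SatCNF]⟩

theorem Unsat.eq_empty_of_singleton {D : Clause} (h : Unsat {D}) : D = ∅ := by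
  by_contra hD
  obtain ⟨ℓ, hℓ⟩ := Finset.nonempty_iff_ne_empty.2 hD
  refine h ⟨fun _ => ℓ.2, fun E hE => ?_⟩
  rw [Finset.mem_singleton.1 hE]
  exact ⟨ℓ, hℓ, rfl⟩

theorem isRefutation_singleton_empty : IsRefutation {∅} [∅] :=
  ⟨by simp, by simp, fun i hi => by
    obtain rfl : i = 0 := by simpa using hi
    simp⟩

/-- if `𝒞` is a set of unsatisfiable formulas closed under
factorisation, `μ` is non-decreasing, and every strongly irreducible member `F` of `𝒞`
has a refutation of length at most `μ(|F|)`, then every `F ∈ 𝒞` has a refutation of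
length at most `(|F| − 1)·μ(|F|) + 1`. -/
theorem polysize_irreducible (𝒞 : Set CNF) (hunsat : ∀ F ∈ 𝒞, Unsat F)
    (hclosed : ClosedUnderFactorisation 𝒞) (μ : ℕ → ℕ) (hmono : Monotone μ)
    (hbase : ∀ F ∈ 𝒞, StronglyIrreducible F →
      ∃ L : List Clause, IsRefutation F L ∧ L.length ≤ μ F.card) :
    ∀ F ∈ 𝒞, ∃ L : List Clause, IsRefutation F L ∧
      L.length ≤ (F.card - 1) * μ F.card + 1 := by
  intro G hG
  induction hm : G.card using Nat.strong_induction_on generalizing G with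
  | _ m ih =>
    subst hm
    have hpos : G.card ≠ 0 := fun h =>
      not_unsat_empty (Finset.card_eq_zero.1 h ▸ hunsat G hG)
    by_cases h1 : G.card = 1
    · obtain ⟨D, rfl⟩ := Finset.card_eq_one.1 h1
      obtain rfl := (hunsat _ hG).eq_empty_of_singleton
      exact ⟨[∅], isRefutation_singleton_empty, by simp⟩
    by_cases hirr : StronglyIrreducible G
    · obtain ⟨L, hL, hlen⟩ := hbase G hG hirr
      have : 1 * μ G.card ≤ (G.card - 1) * μ G.card := Nat.mul_le_mul_right _ (by omega)
      exact ⟨L, hL, by omega⟩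
    have hred : WeaklyReducible G := hirr
    unfold StronglyIrreducible at hirr
    push Not at hirr
    obtain ⟨F, ⟨hFG, C, hint⟩, hF1, hFm⟩ := hirr
    obtain ⟨hR, hI⟩ := hclosed G hG hred F hFG C hint
    have hF0 : F.card ≠ 0 := fun h => by
      rw [Finset.card_eq_zero] at h
      subst h
      exact not_unsat_empty (by simpa [restrictByNegC] using hunsat _ hR)
    have hFle : F.card ≤ G.card := Finset.card_le_card hFG
    have hRcard : (restrictByNegC F C).card ≤ F.card :=
      Finset.card_image_le.trans (Finset.card_filter_le _ _)
    have hIcard : (insert C (G \ F)).card ≤ G.card - F.card + 1 := by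
      rw [← Finset.card_sdiff_of_subset hFG]
      exact Finset.card_insert_le _ _
    obtain ⟨L₁, hL₁, hlen₁⟩ := ih _ (by omega) _ hR rfl
    obtain ⟨L₂, hL₂, hlen₂⟩ := ih _ (by omega) _ hI rfl
    obtain ⟨L, hL, hlen⟩ := exists_isRefutation_of_factorisation hFG hint.1 hL₁ hL₂
    refine ⟨L, hL, ?_⟩
    have hb₁ : ((restrictByNegC F C).card - 1) * μ (restrictByNegC F C).card ≤
        (F.card - 1) * μ G.card :=
      Nat.mul_le_mul (by omega) (hmono (by omega))
    have hb₂ : ((insert C (G \ F)).card - 1) * μ (insert C (G \ F)).card ≤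
        (G.card - F.card) * μ G.card :=
      Nat.mul_le_mul (by omega) (hmono (by omega))
    have hsum : (G.card - 1) * μ G.card =
        (F.card - 1) * μ G.card + (G.card - F.card) * μ G.card := by
      rw [← Nat.add_mul]
      congr 1
      omega
    omega
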